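/- Fix p ∈ (0,1]. For f ∈ C([0,1], ℝ) define ‖f‖_p = sup_{t ∈ [0,1]} ( |f(t)|/t^p + |f(t)|/(1−t)^p ) (with the convention that the supremum is +∞ if the expression is unbounded). Then: (a) every f with ‖f‖_p < ∞ satisfies |f(t)| ≤ 2^p ‖f‖_p t^p (1−t)^p for all t ∈ [0,1]; and (b) there exists a constant C > 0, depending only on p, such that |∫_ℝ f(er(x)) dx| ≤ C ‖f‖_p for every f ∈ C([0,1], ℝ) with ‖f‖_p < ∞. -/

import Mathlib

open MeasureTheory Real

/-- A function continuous on `[0,1]` for which `|f t| / t ^ p + |f t| / (1 - t) ^ p` is bounded by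
`N` in the interior is dominated by `N t ^ p (1 - t) ^ p` up to the endpoints. -/
lemma abs_le_mul_rpow_mul_one_sub_rpow {p N : ℝ} (hp : 0 < p) (hp1 : p ≤ 1) {f : ℝ → ℝ}
    (hf : ContinuousOn f (Set.Icc 0 1))
    (hN : ∀ t ∈ Set.Ioo (0 : ℝ) 1, |f t| / t ^ p + |f t| / (1 - t) ^ p ≤ N)
    {t : ℝ} (ht : t ∈ Set.Icc (0 : ℝ) 1) :
    |f t| ≤ N * (t ^ p * (1 - t) ^ p) := by
  have hcl : closure (Set.Ioo (0 : ℝ) 1) = Set.Icc 0 1 := closure_Ioo (by norm_num)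
  have hint : ∀ s ∈ Set.Ioo (0 : ℝ) 1, |f s| ≤ N * (s ^ p * (1 - s) ^ p) := by
    intro s hs
    have hs1 : 0 < 1 - s := sub_pos.mpr hs.2
    have ha : 0 < s ^ p := rpow_pos_of_pos hs.1 p
    have hb : 0 < (1 - s) ^ p := rpow_pos_of_pos hs1 p
    have hsum : 1 ≤ s ^ p + (1 - s) ^ p := by
      simpa using rpow_add_le_add_rpow hs.1.le hs1.le hp.le hp1
    have h := hN s hs
    rw [div_add_div _ _ ha.ne' hb.ne', div_le_iff₀ (mul_pos ha hb)] at h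
    nlinarith [mul_le_mul_of_nonneg_left hsum (abs_nonneg (f s))]
  refine le_on_closure hint (hcl ▸ hf.abs) ?_ (hcl ▸ ht)
  exact (continuous_const.mul ((continuous_id.rpow_const fun _ => Or.inr hp.le).mul
    ((continuous_const.sub continuous_id).rpow_const fun _ => Or.inr hp.le))).continuousOn

lemma integrable_exp_neg_sq : Integrable fun t : ℝ => exp (-t ^ 2) := by
  simpa using integrable_exp_neg_mul_sq one_pos

lemma setIntegral_Iic_exp_neg_sq_le (x : ℝ) :
    ∫ t in Set.Iic x, exp (-t ^ 2) ≤ exp 1 * exp x := by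
  rw [← integral_exp_Iic x, ← integral_const_mul]
  refine setIntegral_mono integrable_exp_neg_sq.integrableOn
    ((integrableOn_exp_Iic x).const_mul _) fun t => ?_
  rw [← exp_add]
  exact exp_le_exp.mpr (by nlinarith [sq_nonneg (t + 1 / 2)])

lemma setIntegral_Iic_add_setIntegral_Iic_neg_exp_neg_sq (x : ℝ) :
    (∫ t in Set.Iic x, exp (-t ^ 2)) + ∫ t in Set.Iic (-x), exp (-t ^ 2) = √π := by
  have hneg := integral_comp_neg_Iic (-x) fun t : ℝ => exp (-t ^ 2)
  have htot := intervalIntegral.integral_Iic_add_Ioi (b := x)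
    integrable_exp_neg_sq.integrableOn integrable_exp_neg_sq.integrableOn
  have hgauss := integral_gaussian 1
  simp only [neg_sq, neg_neg] at hneg
  simp only [neg_mul, one_mul, div_one] at hgauss
  rw [hneg, htot, hgauss]

lemma integrable_exp_neg_mul_abs {p : ℝ} (hp : 0 < p) :
    Integrable fun x : ℝ => exp (-p * |x|) := by
  rw [← integrableOn_univ, ← Set.Iic_union_Ioi (a := (0 : ℝ))]
  refine IntegrableOn.union ?_ ?_
  · refine (integrableOn_exp_mul_Iic hp 0).congr_fun (fun x hx => ?_) measurableSet_Iic
    simp [abs_of_nonpos (Set.mem_Iic.mp hx)]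
  · refine (exp_neg_integrableOn_Ioi 0 hp).congr_fun (fun x hx => ?_) measurableSet_Ioi
    simp [abs_of_pos (Set.mem_Ioi.mp hx)]

/-- If `a + b = 1` with `a ≤ K eˣ` and `b ≤ K e⁻ˣ`, the product `a ^ p b ^ p` decays
exponentially in `|x|`. -/
lemma rpow_mul_rpow_le_exp_neg_mul_abs {p K a b x : ℝ} (hp : 0 ≤ p) (hK : 0 ≤ K) (ha : 0 ≤ a)
    (hb : 0 ≤ b) (hab : a + b = 1) (hax : a ≤ K * exp x) (hbx : b ≤ K * exp (-x)) :
    a ^ p * b ^ p ≤ K ^ p * exp (-p * |x|) := by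
  have hmul : a * b ≤ K * exp (-|x|) := by
    rcases le_total 0 x with hx | hx
    · rw [abs_of_nonneg hx]
      nlinarith
    · rw [abs_of_nonpos hx, neg_neg]
      nlinarith
  calc a ^ p * b ^ p = (a * b) ^ p := (mul_rpow ha hb).symm
    _ ≤ (K * exp (-|x|)) ^ p := rpow_le_rpow (mul_nonneg ha hb) hmul hp
    _ = K ^ p * exp (-p * |x|) := by
      rw [mul_rpow hK (exp_pos _).le, ← exp_mul]
      ring_nf

/-- For `p ∈ (0,1]` and the Hölder-type norm
`‖f‖_p = sup_{t∈[0,1]} (|f(t)|/t^p + |f(t)|/(1-t)^p)`: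
(a) every `f` with finite norm satisfies `|f(t)| ≤ 2^p ‖f‖_p t^p (1-t)^p`; and
(b) there is `C > 0` depending only on `p` with `|∫_ℝ f(er(x)) dx| ≤ C ‖f‖_p`. -/
theorem holder_norm_bounds_for_I
    (p : ℝ) (hp : p ∈ Set.Ioc (0 : ℝ) 1)
    (er : ℝ → ℝ)
    (her : ∀ x : ℝ, er x = (Real.sqrt π)⁻¹ * ∫ t in Set.Iic x, Real.exp (-t ^ 2))
    (Np : (ℝ → ℝ) → ℝ)
    (hNp : ∀ f : ℝ → ℝ, Np f =
      ⨆ t : Set.Icc (0 : ℝ) 1, (|f t| / (t : ℝ) ^ p + |f t| / (1 - (t : ℝ)) ^ p)) :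
    (∀ f : ℝ → ℝ, ContinuousOn f (Set.Icc 0 1) →
      BddAbove (Set.range fun t : Set.Icc (0 : ℝ) 1 =>
        |f t| / (t : ℝ) ^ p + |f t| / (1 - (t : ℝ)) ^ p) →
      ∀ t ∈ Set.Icc (0 : ℝ) 1,
        |f t| ≤ 2 ^ p * Np f * t ^ p * (1 - t) ^ p) ∧
    (∃ C : ℝ, 0 < C ∧ ∀ f : ℝ → ℝ, ContinuousOn f (Set.Icc 0 1) →
      BddAbove (Set.range fun t : Set.Icc (0 : ℝ) 1 =>
        |f t| / (t : ℝ) ^ p + |f t| / (1 - (t : ℝ)) ^ p) →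
      |∫ x : ℝ, f (er x)| ≤ C * Np f) := by
  obtain ⟨hp0, hp1⟩ := hp
  have hNp0 : ∀ f, 0 ≤ Np f := fun f => by
    rw [hNp]
    exact iSup_nonneg fun t => add_nonneg
      (div_nonneg (abs_nonneg _) (rpow_nonneg t.2.1 p))
      (div_nonneg (abs_nonneg _) (rpow_nonneg (sub_nonneg.mpr t.2.2) p))
  have hbound : ∀ f : ℝ → ℝ, ContinuousOn f (Set.Icc 0 1) →
      BddAbove (Set.range fun t : Set.Icc (0 : ℝ) 1 =>
        |f t| / (t : ℝ) ^ p + |f t| / (1 - (t : ℝ)) ^ p) →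
      ∀ t ∈ Set.Icc (0 : ℝ) 1, |f t| ≤ Np f * (t ^ p * (1 - t) ^ p) := by
    intro f hf hbdd t ht
    refine abs_le_mul_rpow_mul_one_sub_rpow hp0 hp1 hf (fun s hs => ?_) ht
    rw [hNp]
    exact le_ciSup hbdd ⟨s, Set.Ioo_subset_Icc_self hs⟩
  refine ⟨fun f hf hbdd t ht => (hbound f hf hbdd t ht).trans ?_, ?_⟩
  · have h2 : (1 : ℝ) ≤ 2 ^ p := one_le_rpow (by norm_num) hp0.le
    have hnn : 0 ≤ Np f * (t ^ p * (1 - t) ^ p) := mul_nonneg (hNp0 f)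
      (mul_nonneg (rpow_nonneg ht.1 p) (rpow_nonneg (sub_nonneg.mpr ht.2) p))
    nlinarith [mul_le_mul_of_nonneg_right h2 hnn]
  have hπ : 0 < √π := sqrt_pos.mpr pi_pos
  set K : ℝ := (√π)⁻¹ * exp 1 with hK
  have hK0 : 0 < K := by positivity
  have her0 : ∀ x, 0 ≤ er x := fun x => by
    rw [her]
    exact mul_nonneg (by positivity) (integral_nonneg fun t => (exp_pos _).le)
  have her_add : ∀ x, er x + er (-x) = 1 := fun x => by
    rw [her, her, ← mul_add, setIntegral_Iic_add_setIntegral_Iic_neg_exp_neg_sq,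
      inv_mul_cancel₀ hπ.ne']
  have her_le : ∀ x, er x ≤ K * exp x := fun x => by
    rw [her, hK, mul_assoc]
    exact mul_le_mul_of_nonneg_left (setIntegral_Iic_exp_neg_sq_le x) (by positivity)
  have hJ0 : 0 ≤ ∫ x : ℝ, exp (-p * |x|) := integral_nonneg fun x => (exp_pos _).le
  refine ⟨K ^ p * (∫ x : ℝ, exp (-p * |x|)) + 1, by positivity, fun f hf hbdd => ?_⟩
  have hpt : ∀ x, ‖f (er x)‖ ≤ Np f * (K ^ p * exp (-p * |x|)) := by
    intro x
    have hsub : 1 - er x = er (-x) := by linarith [her_add x]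
    have h := hbound f hf hbdd (er x) ⟨her0 x, by linarith [her_add x, her0 (-x)]⟩
    rw [hsub] at h
    exact h.trans (mul_le_mul_of_nonneg_left (rpow_mul_rpow_le_exp_neg_mul_abs hp0.le hK0.le
      (her0 x) (her0 (-x)) (her_add x) (her_le x) (her_le (-x))) (hNp0 f))
  have hle := norm_integral_le_of_norm_le
    (((integrable_exp_neg_mul_abs hp0).const_mul (K ^ p)).const_mul (Np f))
    (Filter.Eventually.of_forall hpt)
  rw [integral_const_mul, integral_const_mul, norm_eq_abs] at hle
  linarith [hNp0 f]
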